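/- Fredholm alternative for compact perturbations of the Riesz isomorphism: let D be a real Hilbert space, let D* be its topological dual (the space of continuous linear functionals on D with the operator norm), let P : D → D* be the Riesz map P(u) = ⟨u, ·⟩, and let K : D → D* be a compact continuous linear operator. If the operator B = P + K is injective, then B is surjective onto D*. -/

import Mathlib

/-- The **Fredholm alternative** for a compact perturbation of an isomorphism `e` of Banach spaces:
if `e + K` is injective, then it is surjective. -/
theorem IsCompactOperator.surjective_equiv_add_of_injective
    {𝕜 E F : Type*} [NontriviallyNormedField 𝕜] [NormedAddCommGroup E] [NormedSpace 𝕜 E]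
    [CompleteSpace E] [NormedAddCommGroup F] [NormedSpace 𝕜 F] (e : E ≃L[𝕜] F) {K : E →L[𝕜] F}
    (hK : IsCompactOperator K) (hinj : Function.Injective ((e : E →L[𝕜] F) + K)) :
    Function.Surjective ((e : E →L[𝕜] F) + K) := by
  have hT : IsCompactOperator ((e.symm : F →L[𝕜] E) ∘L K) := hK.clm_comp (e.symm : F →L[𝕜] E)
  rcases hT.hasEigenvalue_or_mem_resolventSet (neg_ne_zero.mpr one_ne_zero : (-1 : 𝕜) ≠ 0) with h | h
  · obtain ⟨x, hx⟩ := h.exists_hasEigenvector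
    have hx' : e.symm (K x) = -x := by simpa using hx.apply_eq_smul
    have hKx : K x = -e x := by rw [← map_neg, ← hx', e.apply_symm_apply]
    exact absurd (hinj (by simp [hKx] : ((e : E →L[𝕜] F) + K) x = ((e : E →L[𝕜] F) + K) 0)) hx.2
  · intro f
    obtain ⟨u, hu⟩ := (ContinuousLinearMap.isUnit_iff_bijective.mp h).2 (-e.symm f)
    refine ⟨u, ?_⟩
    have hu' : -u - e.symm (K u) = -e.symm f := by simpa using hu
    have := congrArg e hu'
    simp only [map_sub, map_neg, e.apply_symm_apply] at this
    simpa [sub_eq_add_neg, add_comm] using congrArg Neg.neg this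

/-- Fredholm alternative for compact perturbations of the Riesz isomorphism:
if `P : D → D*` is the Riesz map of a real Hilbert space, `K : D → D*` is a
compact continuous linear operator, and `B = P + K` is injective, then `B` is
surjective onto `D*`. -/
theorem riesz_compact_perturbation_alternative
    {D : Type*} [NormedAddCommGroup D] [InnerProductSpace ℝ D] [CompleteSpace D]
    (P K : D →L[ℝ] (D →L[ℝ] ℝ))
    (hP : ∀ u v : D, P u v = (inner ℝ u v : ℝ))
    (hK : IsCompactOperator K)
    (hinj : Function.Injective (P + K)) :
    Function.Surjective (P + K) := by
  let e : D ≃L[ℝ] (D →L[ℝ] ℝ) := (InnerProductSpace.toDual ℝ D).toContinuousLinearEquiv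
  obtain rfl : P = e := by
    ext u v
    exact hP u v
  exact hK.surjective_equiv_add_of_injective e hinj
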